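/- Let B = (A, R) be a blueprint with a zero 0 ∈ A (i.e. 0 ≡ 0 as the empty sum). Then a subset I ⊆ A is an ideal of B if and only if it satisfies: (1) a ∈ I and b ∈ A imply ab ∈ I; (2) 0 ∈ I; and (3) whenever a + Σ b_j ≡ Σ c_k in ℕ[A] with all b_j, c_k ∈ I, then a ∈ I. -/

import Mathlib

/-! Congruences on a blueprint `B = (A, R)`, where `R` is a pre-addition, i.e. a semiring
congruence (`RingCon`) on the monoid semiring `ℕ[A] = MonoidAlgebra ℕ A`. -/

/-- `x` and `y` are termwise related sums: `x = Σ aᵢ`, `y = Σ bᵢ` with `r aᵢ bᵢ` for all `i`. -/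
def Blueprint.Termwise {A : Type*} [CommMonoid A] (r : A → A → Prop)
    (x y : MonoidAlgebra ℕ A) : Prop :=
  ∃ l : List (A × A), (∀ p ∈ l, r p.1 p.2) ∧
    x = (l.map fun p => MonoidAlgebra.of ℕ A p.1).sum ∧
    y = (l.map fun p => MonoidAlgebra.of ℕ A p.2).sum

/-- The linear extension `∼_ℕ` of a relation `∼` on `A` to `ℕ[A]`: the smallest equivalence
relation such that `Σ aᵢ ∼_ℕ Σ bᵢ` whenever `aᵢ ∼ bᵢ` termwise. -/
def Blueprint.LinExt {A : Type*} [CommMonoid A] (r : A → A → Prop) :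
    MonoidAlgebra ℕ A → MonoidAlgebra ℕ A → Prop :=
  Relation.EqvGen (Blueprint.Termwise r)

/-- `∼_R`: the smallest equivalence relation on `ℕ[A]` containing both `R` and `∼_ℕ`. -/
def Blueprint.SimR {A : Type*} [CommMonoid A] (R : RingCon (MonoidAlgebra ℕ A))
    (r : A → A → Prop) : MonoidAlgebra ℕ A → MonoidAlgebra ℕ A → Prop :=
  Relation.EqvGen (fun x y => R x y ∨ Blueprint.LinExt r x y)

/-- A congruence on the blueprint `(A, R)`: an equivalence relation `∼` on `A` such that
(C1) `∼_ℕ` is a pre-addition (additive and multiplicative) and (C2) the restriction of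
`∼_R` to `A` equals `∼`. -/
structure Blueprint.IsCongruence {A : Type*} [CommMonoid A]
    (R : RingCon (MonoidAlgebra ℕ A)) (r : A → A → Prop) : Prop where
  equiv : Equivalence r
  lin_add : ∀ x x' y y' : MonoidAlgebra ℕ A, Blueprint.LinExt r x x' →
    Blueprint.LinExt r y y' → Blueprint.LinExt r (x + y) (x' + y')
  lin_mul : ∀ x x' y y' : MonoidAlgebra ℕ A, Blueprint.LinExt r x x' →
    Blueprint.LinExt r y y' → Blueprint.LinExt r (x * y) (x' * y')
  restrict : ∀ a b : A,
    Blueprint.SimR R r (MonoidAlgebra.of ℕ A a) (MonoidAlgebra.of ℕ A b) ↔ r a b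

/-- A finite chain `x ≡ Σc₁ ∼_ℕ Σd₁ ≡ Σc₂ ∼_ℕ ⋯ ∼_ℕ Σdₙ ≡ y` alternating between the
pre-addition `R` and the linear extension `∼_ℕ` of `∼`. -/
def Blueprint.ChainRel {A : Type*} [CommMonoid A] (R : RingCon (MonoidAlgebra ℕ A))
    (r : A → A → Prop) (x y : MonoidAlgebra ℕ A) : Prop :=
  ∃ z : MonoidAlgebra ℕ A, R x z ∧
    Relation.ReflTransGen (fun u v => ∃ w, Blueprint.LinExt r u w ∧ R w v) z y

/-- The equivalence relation `∼^I` on `A` associated to a subset `I ⊆ A`: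
`a ∼^I b` iff `a = b` or `a, b ∈ I`. -/
def Blueprint.relOfSet {A : Type*} (I : Set A) : A → A → Prop :=
  fun a b => a = b ∨ (a ∈ I ∧ b ∈ I)

/-- The relation `∼_I` on `A`: the restriction to `A` of the smallest equivalence relation
on `ℕ[A]` containing `R` and the linear extension of `∼^I`. -/
def Blueprint.SimI {A : Type*} [CommMonoid A] (R : RingCon (MonoidAlgebra ℕ A))
    (I : Set A) : A → A → Prop :=
  fun a b => Blueprint.SimR R (Blueprint.relOfSet I)
    (MonoidAlgebra.of ℕ A a) (MonoidAlgebra.of ℕ A b)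

/-- An ideal of the blueprint `B = (A, R)`. -/
structure Blueprint.IsIdeal {A : Type*} [CommMonoid A]
    (R : RingCon (MonoidAlgebra ℕ A)) (I : Set A) : Prop where
  mul_mem : ∀ a ∈ I, ∀ b : A, a * b ∈ I
  zero_mem : ∀ e : A, R (MonoidAlgebra.of ℕ A e) 0 → e ∈ I
  closed : ∀ a b : A, Blueprint.SimI R I a b → b ∈ I → a ∈ I

/-- `x ∈ ℕ[A]` is a (possibly empty) sum `Σ bⱼ` with all `bⱼ ∈ I`. -/
def Blueprint.SumOf {A : Type*} [CommMonoid A] (I : Set A) (x : MonoidAlgebra ℕ A) : Prop :=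
  ∃ l : List A, (∀ b ∈ l, b ∈ I) ∧ x = (l.map (MonoidAlgebra.of ℕ A)).sum

namespace Blueprint

variable {A : Type*} [CommMonoid A] {R : RingCon (MonoidAlgebra ℕ A)} {I : Set A}

theorem SumOf.zero : SumOf I 0 := ⟨[], by simp, by simp⟩

theorem SumOf.of {a : A} (ha : a ∈ I) : SumOf I (MonoidAlgebra.of ℕ A a) :=
  ⟨[a], by simpa using ha, by simp⟩

theorem SumOf.add {x y : MonoidAlgebra ℕ A} (hx : SumOf I x) (hy : SumOf I y) :
    SumOf I (x + y) := by
  obtain ⟨l, hl, rfl⟩ := hx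
  obtain ⟨m, hm, rfl⟩ := hy
  refine ⟨l ++ m, fun b hb => ?_, by simp⟩
  exact (List.mem_append.1 hb).elim (hl b) (hm b)

/-- `x` and `y` become congruent after adding sums of elements of `I`. -/
def StablyRel (R : RingCon (MonoidAlgebra ℕ A)) (I : Set A) (x y : MonoidAlgebra ℕ A) : Prop :=
  ∃ s t, SumOf I s ∧ SumOf I t ∧ R (x + s) (y + t)

theorem StablyRel.of_rel {x y : MonoidAlgebra ℕ A} (h : R x y) : StablyRel R I x y :=
  ⟨0, 0, .zero, .zero, by simpa using h⟩

theorem StablyRel.equivalence : Equivalence (StablyRel R I) where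
  refl x := .of_rel (R.refl x)
  symm := fun ⟨s, t, hs, ht, h⟩ => ⟨t, s, ht, hs, R.symm h⟩
  trans {x y w} := by
    rintro ⟨s, t, hs, ht, h⟩ ⟨s', t', hs', ht', h'⟩
    refine ⟨s + s', t' + t, hs.add hs', ht'.add ht, ?_⟩
    have h₁ : R (x + (s + s')) (y + t + s') := by
      simpa only [add_assoc] using R.add h (R.refl s')
    have h₂ : R (y + t + s') (w + (t' + t)) := by
      simpa only [add_assoc, add_comm s' t] using R.add h' (R.refl t)
    exact R.trans h₁ h₂

theorem StablyRel.add {x x' y y' : MonoidAlgebra ℕ A} (h : StablyRel R I x y)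
    (h' : StablyRel R I x' y') : StablyRel R I (x + x') (y + y') := by
  obtain ⟨s, t, hs, ht, h⟩ := h
  obtain ⟨s', t', hs', ht', h'⟩ := h'
  refine ⟨s + s', t + t', hs.add hs', ht.add ht', ?_⟩
  rw [add_add_add_comm x, add_add_add_comm y]
  exact R.add h h'

theorem StablyRel.of_termwise {x y : MonoidAlgebra ℕ A} (h : Termwise (relOfSet I) x y) :
    StablyRel R I x y := by
  obtain ⟨l, hl, rfl, rfl⟩ := h
  induction l with
  | nil => exact .of_rel (R.refl _)
  | cons p l ih =>
    simp only [List.map_cons, List.sum_cons]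
    refine StablyRel.add ?_ (ih fun q hq => hl q (List.mem_cons_of_mem _ hq))
    rcases hl p List.mem_cons_self with h | ⟨h₁, h₂⟩
    · rw [h]
      exact .of_rel (R.refl _)
    · refine ⟨_, _, .of h₂, .of h₁, ?_⟩
      rw [add_comm]
      exact R.refl _

theorem StablyRel.of_simR {x y : MonoidAlgebra ℕ A} (h : SimR R (relOfSet I) x y) :
    StablyRel R I x y := by
  refine equivalence.eqvGen_iff.1 (h.mono fun u v huv => ?_)
  rcases huv with huv | huv
  · exact .of_rel huv
  · exact equivalence.eqvGen_iff.1 (huv.mono fun _ _ => .of_termwise)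

theorem SumOf.exists_termwise_zero {x : MonoidAlgebra ℕ A} (hx : SumOf I x) {z : A}
    (hzI : z ∈ I) (hz : R (MonoidAlgebra.of ℕ A z) 0) (l : List A) :
    ∃ w, R w 0 ∧ Termwise (relOfSet I) ((l.map (MonoidAlgebra.of ℕ A)).sum + x)
      ((l.map (MonoidAlgebra.of ℕ A)).sum + w) := by
  obtain ⟨m, hm, rfl⟩ := hx
  refine ⟨(m.map fun _ => MonoidAlgebra.of ℕ A z).sum, ?_,
    l.map (fun a => (a, a)) ++ m.map (fun b => (b, z)), ?_, ?_, ?_⟩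
  · clear hm
    induction m with
    | nil => exact R.refl _
    | cons b m ih => simpa using R.add hz ih
  · intro p hp
    rcases List.mem_append.1 hp with hp | hp
    · obtain ⟨a, -, rfl⟩ := List.mem_map.1 hp
      exact .inl rfl
    · obtain ⟨b, hb, rfl⟩ := List.mem_map.1 hp
      exact .inr ⟨hm b hb, hzI⟩
  · simp only [List.map_append, List.map_map, Function.comp_def, List.sum_append]
  · simp only [List.map_append, List.map_map, Function.comp_def, List.sum_append]

/-- Adding a sum of elements of `I` does not change the class of a sum modulo `I`. -/
theorem SumOf.simR_add {x : MonoidAlgebra ℕ A} (hx : SumOf I x) {z : A}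
    (hzI : z ∈ I) (hz : R (MonoidAlgebra.of ℕ A z) 0) (l : List A) :
    SimR R (relOfSet I) ((l.map (MonoidAlgebra.of ℕ A)).sum + x)
      (l.map (MonoidAlgebra.of ℕ A)).sum := by
  obtain ⟨w, hw, h⟩ := hx.exists_termwise_zero hzI hz l
  refine .trans _ _ _ (.rel _ _ (.inr (.rel _ _ h))) (.rel _ _ (.inl ?_))
  simpa using R.add (R.refl _) hw

end Blueprint

/-- Let `B = (A, R)` be a blueprint with a zero `0 ∈ A` (i.e. an element `z`
with `z ≡ 0`). Then `I ⊆ A` is an ideal of `B` iff (1) `a ∈ I` and `b ∈ A` imply `ab ∈ I`;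
(2) `z ∈ I`; and (3) whenever `a + Σ bⱼ ≡ Σ cₖ` in `ℕ[A]` with all `bⱼ, cₖ ∈ I`,
then `a ∈ I`. -/
theorem blueprint_ideal_iff_of_hasZero {A : Type*} [CommMonoid A]
    (R : RingCon (MonoidAlgebra ℕ A)) (z : A) (hz : R (MonoidAlgebra.of ℕ A z) 0)
    (I : Set A) :
    Blueprint.IsIdeal R I ↔
      ((∀ a ∈ I, ∀ b : A, a * b ∈ I) ∧
       z ∈ I ∧
       (∀ (a : A) (x y : MonoidAlgebra ℕ A), Blueprint.SumOf I x → Blueprint.SumOf I y →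
         R (MonoidAlgebra.of ℕ A a + x) y → a ∈ I)) := by
  constructor
  · intro h
    have hzI := h.zero_mem z hz
    refine ⟨h.mul_mem, hzI, fun a x y hx hy hxy => h.closed a z ?_ hzI⟩
    have hax := hx.simR_add hzI hz [a]
    have hy0 := hy.simR_add hzI hz []
    simp only [List.map_cons, List.map_nil, List.sum_cons, List.sum_nil, add_zero,
      zero_add] at hax hy0
    exact .trans _ _ _ (.symm _ _ hax) (.trans _ _ _ (.rel _ _ (.inl hxy))
      (.trans _ _ _ hy0 (.rel _ _ (.inl (R.symm hz)))))
  · rintro ⟨hmul, -, hclosed⟩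
    refine ⟨hmul, fun e he => hclosed e 0 0 .zero .zero (by simpa using he), fun a b hab hb => ?_⟩
    obtain ⟨s, t, hs, ht, h⟩ := Blueprint.StablyRel.of_simR hab
    exact hclosed a s _ hs (.add (.of hb) ht) h
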